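/- arXiv:1210.2905 — 5 statements merged into one kernel-verified Lean document; each statement's English description precedes it below -/
import Mathlib

section
/- Let j ≥ 1 be an integer and let S_X(j) = R(j) ∪ ([−(2j+1),0] × [0,2j+1]) ∪ ([−(2j+1),2j] × [−(4j+1),0]) be the region of P_X(j); then Area(S_X(j)) − N(S_X(j)) − (22j² + 13j + 2) = 0, where N denotes the number of reflex corners. For an integer m ≥ 2, let S_X(−m) = R₋(m) ∪ ([−(2m−1),0] × [0,2m−1]) ∪ ([−(2m−1),2m] × [−(4m−1),0]) be the region of P_X(−m); then Area(S_X(−m)) − N(S_X(−m)) − (22m² − 13m + 2) = 1. In particular, Area minus the number of reflex corners minus the lens space surgery coefficient 22j² + 13j + 2 of k_X(j) is always 0 or 1. -/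
open MeasureTheory Set ENNReal

/-- The recursively defined sequence of lattice points `(a_i^{(j)}, b_i^{(j)})`
(`ab j i` is `(a_i^{(j)}, b_i^{(j)})` for `1 ≤ i ≤ j+1`):
`[(a_i,b_i)^{(1)}] = [(1,3),(2,1)]`, and for `j ≥ 2`,
`(a_1,b_1)^{(j)} = (1, 2j+1)` and
`(a_i,b_i)^{(j)} = (b_{j+2−i}^{(j−1)} + 1, a_{j+2−i}^{(j−1)} + 1)` for `2 ≤ i ≤ j+1`. -/
def ab : ℕ → ℕ → ℤ × ℤ
  | 0, _ => (0, 0)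
  | 1, i => if i = 1 then (1, 3) else if i = 2 then (2, 1) else (0, 0)
  | (j + 2), i =>
      if i = 1 then (1, 2 * (j + 2) + 1)
      else ((ab (j + 1) ((j + 2) + 2 - i)).2 + 1, (ab (j + 1) ((j + 2) + 2 - i)).1 + 1)

/-- The region `R(j) = ⋃_{i=1}^{j+1} [0, a_i^{(j)}] × [0, b_i^{(j)}] ⊆ ℝ²`. -/
def Rreg (j : ℕ) : Set (ℝ × ℝ) :=
  ⋃ i ∈ Finset.Icc 1 (j + 1),
    Set.Icc (0 : ℝ) ((ab j i).1 : ℝ) ×ˢ Set.Icc (0 : ℝ) ((ab j i).2 : ℝ)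

/-- The region `R₋(m) = ⋃_{i=1}^{m} [0, 2i] × [0, 2m+1−2i] ⊆ ℝ²`
(the region of the plane curve `P(−m)` for `m ≥ 2`). -/
def Rneg (m : ℕ) : Set (ℝ × ℝ) :=
  ⋃ i ∈ Finset.Icc 1 m,
    Set.Icc (0 : ℝ) (2 * (i : ℝ)) ×ˢ Set.Icc (0 : ℝ) (2 * (m : ℝ) + 1 - 2 * (i : ℝ))

/-- The region of `P_X(j)` for `j ≥ 1`:
`S_X(j) = R(j) ∪ ([−(2j+1),0] × [0,2j+1]) ∪ ([−(2j+1),2j] × [−(4j+1),0])`. -/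
def SX (j : ℕ) : Set (ℝ × ℝ) :=
  Rreg j ∪
    Set.Icc (-(2 * (j : ℝ) + 1)) (0 : ℝ) ×ˢ Set.Icc (0 : ℝ) (2 * (j : ℝ) + 1) ∪
    Set.Icc (-(2 * (j : ℝ) + 1)) (2 * (j : ℝ)) ×ˢ Set.Icc (-(4 * (j : ℝ) + 1)) (0 : ℝ)

/-- The region of `P_X(−m)` for `m ≥ 2`:
`S_X(−m) = R₋(m) ∪ ([−(2m−1),0] × [0,2m−1]) ∪ ([−(2m−1),2m] × [−(4m−1),0])`. -/
def SXneg (m : ℕ) : Set (ℝ × ℝ) :=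
  Rneg m ∪
    Set.Icc (-(2 * (m : ℝ) - 1)) (0 : ℝ) ×ˢ Set.Icc (0 : ℝ) (2 * (m : ℝ) - 1) ∪
    Set.Icc (-(2 * (m : ℝ) - 1)) (2 * (m : ℝ)) ×ˢ Set.Icc (-(4 * (m : ℝ) - 1)) (0 : ℝ)

/-- `p` is a reflex corner (concave point) of the closed region `R ⊆ ℝ²`:
there are `ε > 0` and signs `σ, τ ∈ {−1, +1}` such that
`R ∩ B(p,ε) = {q ∈ B(p,ε) : σ(q₁ − p₁) ≤ 0 or τ(q₂ − p₂) ≤ 0}`. -/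
def IsReflexCorner (R : Set (ℝ × ℝ)) (p : ℝ × ℝ) : Prop :=
  ∃ ε : ℝ, 0 < ε ∧ ∃ σ τ : ℝ, (σ = 1 ∨ σ = -1) ∧ (τ = 1 ∨ τ = -1) ∧
    R ∩ Metric.ball p ε =
      {q ∈ Metric.ball p ε | σ * (q.1 - p.1) ≤ 0 ∨ τ * (q.2 - p.2) ≤ 0}

/-- The union of the rectangles `[-w, a i] × [-h, b i]` for `i ≤ n`. -/
def staircase (a b : ℕ → ℝ) (w h : ℝ) (n : ℕ) : Set (ℝ × ℝ) :=
  {q | -w ≤ q.1 ∧ -h ≤ q.2 ∧ ∃ i ≤ n, q.1 ≤ a i ∧ q.2 ≤ b i}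

section Staircase

variable {a b : ℕ → ℝ} {w h : ℝ} {n : ℕ}

lemma union_rectangles_eq_staircase (ha : StrictMono a) (hb : StrictAnti b)
    (ha0 : 0 ≤ a 0) (hbn : 0 ≤ b n) (hw : 0 ≤ w) (hh : 0 ≤ h) :
    {q : ℝ × ℝ | ∃ i ≤ n, q ∈ Icc 0 (a i) ×ˢ Icc 0 (b i)} ∪ Icc (-w) 0 ×ˢ Icc 0 (b 0) ∪
      Icc (-w) (a n) ×ˢ Icc (-h) 0 = staircase a b w h n := by
  ext ⟨x, y⟩
  simp only [staircase, mem_union, mem_ofPred_eq, mem_prod, mem_Icc]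
  constructor
  · rintro ((⟨i, hi, ⟨h1, h2⟩, h3, h4⟩ | ⟨⟨h1, h2⟩, h3, h4⟩) | ⟨⟨h1, h2⟩, h3, h4⟩)
    · exact ⟨by linarith, by linarith, i, hi, h2, h4⟩
    · exact ⟨h1, by linarith, 0, n.zero_le, by linarith, h4⟩
    · exact ⟨h1, h3, n, le_rfl, h2, by linarith⟩
  · rintro ⟨h1, h2, i, hi, h3, h4⟩
    have hai : a i ≤ a n := ha.monotone hi
    have hbi : b i ≤ b 0 := hb.antitone i.zero_le
    rcases le_total y 0 with hy | hy
    · exact Or.inr ⟨⟨h1, by linarith⟩, h2, hy⟩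
    · rcases le_total x 0 with hx | hx
      · exact Or.inl (Or.inr ⟨⟨h1, hx⟩, hy, by linarith⟩)
      · exact Or.inl (Or.inl ⟨i, hi, ⟨hx, h3⟩, hy, h4⟩)

lemma staircase_zero : staircase a b w h 0 = Icc (-w) (a 0) ×ˢ Icc (-h) (b 0) := by
  ext ⟨x, y⟩
  simp only [staircase, mem_ofPred_eq, mem_prod, mem_Icc, Nat.le_zero, exists_eq_left]
  tauto

lemma staircase_succ (ha : StrictMono a) (hb : StrictAnti b) (hw : -w ≤ a 0) :
    staircase a b w h (n + 1) =
      staircase a b w h n ∪ Ioc (a n) (a (n + 1)) ×ˢ Icc (-h) (b (n + 1)) := by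
  ext ⟨x, y⟩
  simp only [staircase, mem_union, mem_ofPred_eq, mem_prod, mem_Icc, mem_Ioc]
  have han : a 0 ≤ a n := ha.monotone n.zero_le
  have hbn : b (n + 1) < b n := hb n.lt_succ_self
  constructor
  · rintro ⟨h1, h2, i, hi, h3, h4⟩
    rcases Nat.le_succ_iff.mp hi with hi | rfl
    · exact Or.inl ⟨h1, h2, i, hi, h3, h4⟩
    · rcases le_or_gt x (a n) with hx | hx
      · exact Or.inl ⟨h1, h2, n, le_rfl, hx, by linarith⟩
      · exact Or.inr ⟨⟨hx, h3⟩, h2, h4⟩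
  · rintro (⟨h1, h2, i, hi, h3, h4⟩ | ⟨⟨h1, h2⟩, h3, h4⟩)
    · exact ⟨h1, h2, i, by omega, h3, h4⟩
    · exact ⟨by linarith, h3, n + 1, le_rfl, h2, h4⟩

lemma volume_staircase (ha : StrictMono a) (hb : StrictAnti b) (hw : -w ≤ a 0) (hh : -h ≤ b n) :
    volume (staircase a b w h n) = ENNReal.ofReal
      ((a 0 + w) * (b 0 + h) +
        ∑ i ∈ Finset.range n, (a (i + 1) - a i) * (b (i + 1) + h)) := by
  induction n with
  | zero =>
    rw [staircase_zero, Measure.volume_eq_prod, Measure.prod_prod, Real.volume_Icc,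
      Real.volume_Icc, ← ENNReal.ofReal_mul (by linarith)]
    simp
  | succ n ih =>
    have hbn : b (n + 1) < b n := hb n.lt_succ_self
    have hb0 : b n ≤ b 0 := hb.antitone n.zero_le
    have han : a n < a (n + 1) := ha n.lt_succ_self
    have hdisj : Disjoint (staircase a b w h n)
        (Ioc (a n) (a (n + 1)) ×ˢ Icc (-h) (b (n + 1))) := by
      rw [Set.disjoint_left]
      rintro ⟨x, y⟩ ⟨_, _, i, hi, hx, _⟩ ⟨⟨hx', _⟩, _⟩
      have : a i ≤ a n := ha.monotone hi
      simp only at hx hx'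
      linarith
    have hsum : 0 ≤ ∑ i ∈ Finset.range n, (a (i + 1) - a i) * (b (i + 1) + h) := by
      refine Finset.sum_nonneg fun i hi ↦ mul_nonneg ?_ ?_
      · linarith [ha i.lt_succ_self]
      · have : b n ≤ b (i + 1) := hb.antitone (Finset.mem_range.mp hi)
        linarith
    rw [staircase_succ ha hb hw,
      measure_union hdisj (measurableSet_Ioc.prod measurableSet_Icc), ih (by linarith),
      Measure.volume_eq_prod, Measure.prod_prod, Real.volume_Ioc, Real.volume_Icc,
      ← ENNReal.ofReal_mul (by linarith), ← ENNReal.ofReal_add, Finset.sum_range_succ]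
    · ring_nf
    · exact add_nonneg (mul_nonneg (by linarith) (by linarith)) hsum
    · exact mul_nonneg (by linarith) (by linarith)

lemma isReflexCorner_staircase (ha : StrictMono a) (hb : StrictAnti b)
    (hw : -w < a 0) (hh : -h < b n) {i : ℕ} (hi : i < n) :
    IsReflexCorner (staircase a b w h n) (a i, b (i + 1)) := by
  have h1 : a 0 ≤ a i := ha.monotone i.zero_le
  have h2 : b n ≤ b (i + 1) := hb.antitone hi
  have h3 : a i < a (i + 1) := ha i.lt_succ_self
  have h4 : b (i + 1) < b i := hb i.lt_succ_self
  refine ⟨min (min (a (i + 1) - a i) (b i - b (i + 1))) (min (a i + w) (b (i + 1) + h)),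
    lt_min (lt_min (by linarith) (by linarith)) (lt_min (by linarith) (by linarith)),
    1, 1, Or.inl rfl, Or.inl rfl, ?_⟩
  ext ⟨x, y⟩
  simp only [staircase, mem_inter_iff, mem_ofPred_eq, Metric.mem_ball, Prod.dist_eq, max_lt_iff,
    Real.dist_eq, lt_min_iff, abs_lt, one_mul, sub_nonpos]
  constructor
  · rintro ⟨⟨_, _, k, _, hx, hy⟩, hball⟩
    refine ⟨hball, ?_⟩
    rcases Nat.lt_or_ge i k with hk | hk
    · exact Or.inr (hy.trans (hb.antitone hk))
    · exact Or.inl (hx.trans (ha.monotone hk))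
  · rintro ⟨hball, hxy⟩
    refine ⟨⟨by linarith, by linarith, ?_⟩, hball⟩
    rcases hxy with hx | hy
    · exact ⟨i, hi.le, hx, by linarith⟩
    · exact ⟨i + 1, hi, by linarith, hy⟩

lemma exists_of_isReflexCorner_staircase (ha : StrictMono a) (hb : StrictAnti b) {p : ℝ × ℝ}
    (hp : IsReflexCorner (staircase a b w h n) p) :
    ∃ i < n, (a i, b (i + 1)) = p := by
  obtain ⟨x, y⟩ := p
  obtain ⟨ε, hε, σ, τ, hσ, hτ, heq⟩ := hp
  have key : ∀ s t : ℝ, |s| < ε → |t| < ε →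
      ((x + s, y + t) ∈ staircase a b w h n ↔ σ * s ≤ 0 ∨ τ * t ≤ 0) := by
    intro s t hs ht
    have hball : (x + s, y + t) ∈ Metric.ball (x, y) ε := by
      simp [Prod.dist_eq, hs, ht]
    have := Set.ext_iff.mp heq (x + s, y + t)
    simpa only [mem_inter_iff, mem_ofPred_eq, hball, and_true, true_and,
      add_sub_cancel_left] using this
  have hd : |ε / 2| < ε := by rw [abs_of_pos (by linarith)]; linarith
  have hd' : |-(ε / 2)| < ε := by rwa [abs_neg]
  have hz : |(0 : ℝ)| < ε := by simpa using hε
  have hx0 : -w ≤ x - ε / 2 := by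
    rcases hτ with rfl | rfl
    · exact ((key (-(ε / 2)) (-(ε / 2)) hd' hd').mpr (Or.inr (by linarith))).1
    · exact ((key (-(ε / 2)) (ε / 2) hd' hd).mpr (Or.inr (by linarith))).1
  have hy0 : -h ≤ y - ε / 2 := by
    rcases hσ with rfl | rfl
    · exact ((key (-(ε / 2)) (-(ε / 2)) hd' hd').mpr (Or.inl (by linarith))).2.1
    · exact ((key (ε / 2) (-(ε / 2)) hd hd').mpr (Or.inl (by linarith))).2.1
  have down : ∀ s t s' t' : ℝ, s' ≤ s → t' ≤ t → -(ε / 2) ≤ s' → -(ε / 2) ≤ t' →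
      (x + s, y + t) ∈ staircase a b w h n → (x + s', y + t') ∈ staircase a b w h n := by
    rintro s t s' t' hs ht hs' ht' ⟨_, _, i, hi, h3, h4⟩
    simp only at h3 h4
    exact ⟨by simp only; linarith, by simp only; linarith, i, hi,
      by simp only; linarith, by simp only; linarith⟩
  obtain rfl : σ = 1 := by
    refine hσ.resolve_right ?_
    rintro rfl
    rcases hτ with rfl | rfl
    · have h1 := (key (ε / 2) (ε / 2) hd hd).mpr (Or.inl (by linarith))
      have h2 := (key _ _ hd' hd).mp
        (down _ _ (-(ε / 2)) (ε / 2) (by linarith) le_rfl le_rfl (by linarith) h1)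
      rcases h2 with h2 | h2 <;> linarith
    · have h1 := (key (ε / 2) (-(ε / 2)) hd hd').mpr (Or.inl (by linarith))
      have h2 := (key _ _ hd' hd').mp
        (down _ _ (-(ε / 2)) (-(ε / 2)) (by linarith) le_rfl le_rfl le_rfl h1)
      rcases h2 with h2 | h2 <;> linarith
  obtain rfl : τ = 1 := by
    refine hτ.resolve_right ?_
    rintro rfl
    have h1 := (key (ε / 2) (ε / 2) hd hd).mpr (Or.inr (by linarith))
    have h2 := (key _ _ hd hd').mp
      (down _ _ (ε / 2) (-(ε / 2)) le_rfl (by linarith) (by linarith) le_rfl h1)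
    rcases h2 with h2 | h2 <;> linarith
  have hnot : ∀ i ≤ n, x < a i → b i ≤ y := by
    intro i hi hxi
    by_contra! hyi
    set δ := min (ε / 2) (min (a i - x) (b i - y)) with hδ
    have hδ0 : 0 < δ := lt_min (by linarith) (lt_min (by linarith) (by linarith))
    have hδ1 : δ ≤ ε / 2 := min_le_left _ _
    have hδ2 : δ ≤ a i - x := (min_le_right _ _).trans (min_le_left _ _)
    have hδ3 : δ ≤ b i - y := (min_le_right _ _).trans (min_le_right _ _)
    have hδ4 : |δ| < ε := by rw [abs_of_pos hδ0]; linarith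
    have hmem : (x + δ, y + δ) ∈ staircase a b w h n :=
      ⟨by simp only; linarith, by simp only; linarith, i, hi,
        by simp only; linarith, by simp only; linarith⟩
    rcases (key δ δ hδ4 hδ4).mp hmem with h2 | h2 <;> linarith
  obtain ⟨-, -, i, hi, hxi, hyi⟩ := (key 0 (ε / 2) hz hd).mpr (Or.inl (by simp))
  obtain ⟨-, -, k, hk, hxk, hyk⟩ := (key (ε / 2) 0 hd hz).mpr (Or.inr (by simp))
  simp only [add_zero] at hxi hyi hxk hyk
  have hx : a i = x := by
    refine le_antisymm ?_ hxi
    by_contra! hlt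
    linarith [hnot i hi hlt]
  have hy : b k = y := le_antisymm (hnot k hk (by linarith)) hyk
  have hik : i < k := ha.lt_iff_lt.mp (by linarith)
  have hki : k ≤ i + 1 := by
    have : b (i + 1) ≤ b k := by
      rw [hy]
      exact hnot (i + 1) (by omega) (by rw [← hx]; exact ha i.lt_succ_self)
    exact hb.le_iff_ge.mp this
  obtain rfl : k = i + 1 := by omega
  exact ⟨i, hk, by rw [hx, hy]⟩

lemma ncard_isReflexCorner_staircase (ha : StrictMono a) (hb : StrictAnti b)
    (hw : -w < a 0) (hh : -h < b n) :
    Set.ncard {p : ℝ × ℝ | IsReflexCorner (staircase a b w h n) p} = n := by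
  have himage : {p : ℝ × ℝ | IsReflexCorner (staircase a b w h n) p} =
      (fun i ↦ (a i, b (i + 1))) '' (Finset.range n : Set ℕ) := by
    ext p
    simp only [mem_ofPred_eq, mem_image, Finset.coe_range, mem_Iio]
    constructor
    · exact exists_of_isReflexCorner_staircase ha hb
    · rintro ⟨i, hi, rfl⟩
      exact isReflexCorner_staircase ha hb hw hh hi
  rw [himage, Set.ncard_image_of_injective _ fun i k hik ↦ ha.injective (congrArg Prod.fst hik),
    Set.ncard_coe_finset, Finset.card_range]

end Staircase

/-- The closed form of `a_{i+1}^{(j)}`. -/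
def stepA (j i : ℕ) : ℤ := if i < (j + 1) / 2 then 2 * i + 1 else 2 * i

/-- The closed form of `b_{i+1}^{(j)}`. -/
def stepB (j i : ℕ) : ℤ := if i ≤ (j + 1) / 2 then 2 * (j - i) + 1 else 2 * (j - i) + 2

lemma ab_succ_eq (j : ℕ) (hj : 1 ≤ j) : ∀ i ≤ j, ab j (i + 1) = (stepA j i, stepB j i) := by
  induction j, hj using Nat.le_induction with
  | base =>
    intro i hi
    interval_cases i <;> simp [ab, stepA, stepB]
  | succ j hj ih =>
    obtain ⟨j, rfl⟩ := Nat.exists_eq_add_of_le' hj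
    intro i hi
    rcases i with _ | i
    · simp only [ab, stepA, stepB, if_true, zero_add, Prod.mk.injEq]
      constructor <;> split_ifs <;> push_cast <;> omega
    · have hidx : j + 2 + 2 - (i + 1 + 1) = (j + 1 - i) + 1 := by omega
      rw [ab, if_neg (by omega), hidx, ih _ (by omega)]
      simp only [stepA, stepB, Prod.mk.injEq]
      constructor <;> split_ifs <;> push_cast <;> omega

lemma stepA_strictMono (j : ℕ) : StrictMono (stepA j) := by
  refine strictMono_nat_of_lt_succ fun i ↦ ?_
  simp only [stepA]
  split_ifs <;> push_cast <;> omega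

lemma stepB_strictAnti (j : ℕ) : StrictAnti (stepB j) := by
  refine strictAnti_nat_of_succ_lt fun i ↦ ?_
  simp only [stepB]
  split_ifs <;> push_cast <;> omega

lemma sum_range_stepA_stepB {j : ℕ} (hj : 1 ≤ j) (h : ℤ) (n : ℕ) :
    ∑ i ∈ Finset.range n, (stepA j (i + 1) - stepA j i) * (stepB j (i + 1) + h) =
      2 * n * (2 * j - n) + (stepA j n - 1) * h -
        if n < (j + 1) / 2 then 0 else 2 * ((j : ℤ) - n) + 1 := by
  obtain ⟨c, hc⟩ : ∃ c, c = (j + 1) / 2 := ⟨_, rfl⟩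
  have hc1 : 1 ≤ c := by omega
  simp only [stepA, stepB, ← hc]
  induction n with
  | zero => simp [show 0 < c by omega]
  | succ n ih =>
    rw [Finset.sum_range_succ, ih]
    rcases lt_trichotomy (n + 1) c with hn | rfl | hn
    · simp only [hn, hn.le, show n < c by omega, if_true]
      push_cast
      ring
    · simp only [lt_irrefl, le_refl, n.lt_succ_self, if_true, if_false]
      push_cast
      ring
    · simp only [show ¬ n + 1 < c by omega, show ¬ n + 1 ≤ c by omega, show ¬ n < c by omega,
        if_false]
      push_cast
      ring

lemma stepA_zero {j : ℕ} (hj : 1 ≤ j) : stepA j 0 = 1 := by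
  simp only [stepA]
  split_ifs
  · simp
  · omega

lemma stepA_self {j : ℕ} (hj : 1 ≤ j) : stepA j j = 2 * j := by
  simp only [stepA]
  split_ifs
  · omega
  · rfl

lemma stepA_cast_strictMono (j : ℕ) : StrictMono fun i ↦ (stepA j i : ℝ) :=
  Int.cast_strictMono.comp (stepA_strictMono j)

lemma stepB_cast_strictAnti (j : ℕ) : StrictAnti fun i ↦ (stepB j i : ℝ) :=
  Int.cast_strictMono.comp_strictAnti (stepB_strictAnti j)

lemma stepB_zero (j : ℕ) : stepB j 0 = 2 * j + 1 := by
  simp [stepB]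

lemma stepB_self_pos (j : ℕ) : 0 < stepB j j := by
  simp only [stepB]
  split_ifs <;> omega

lemma SX_eq_staircase {j : ℕ} (hj : 1 ≤ j) :
    SX j = staircase (fun i ↦ stepA j i) (fun i ↦ stepB j i) (2 * j + 1) (4 * j + 1) j := by
  rw [← union_rectangles_eq_staircase (stepA_cast_strictMono j)
    (stepB_cast_strictAnti j)
    (by simp [stepA_zero hj]) (by exact_mod_cast (stepB_self_pos j).le)
    (by positivity) (by positivity), SX]
  refine congrArg₂ (· ∪ ·) (congrArg₂ (· ∪ ·) ?_ ?_) ?_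
  · ext q
    simp only [Rreg, mem_iUnion, Finset.mem_Icc, mem_ofPred_eq, exists_prop]
    constructor
    · rintro ⟨i, ⟨h1, h2⟩, hq⟩
      obtain ⟨i, rfl⟩ := Nat.exists_eq_add_of_le' h1
      rw [ab_succ_eq j hj i (by omega)] at hq
      exact ⟨i, by omega, hq⟩
    · rintro ⟨i, hi, hq⟩
      refine ⟨i + 1, ⟨by omega, by omega⟩, ?_⟩
      rwa [ab_succ_eq j hj i hi]
  · simp [stepB_zero]
  · simp [stepA_self hj]

lemma SXneg_eq_staircase {m : ℕ} (hm : 1 ≤ m) :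
    SXneg m = staircase (fun i ↦ 2 * (i + 1)) (fun i ↦ 2 * m - 1 - 2 * i)
      (2 * m - 1) (4 * m - 1) (m - 1) := by
  obtain ⟨n, rfl⟩ := Nat.exists_eq_add_of_le' hm
  rw [← union_rectangles_eq_staircase (fun i k hik ↦ by simpa using hik)
    (fun i k hik ↦ by simpa using hik) (by simp) (by push_cast [Nat.add_sub_cancel]; linarith)
    (by push_cast; linarith [n.cast_nonneg (α := ℝ)])
    (by push_cast; linarith [n.cast_nonneg (α := ℝ)]), SXneg]
  refine congrArg₂ (· ∪ ·) (congrArg₂ (· ∪ ·) ?_ ?_) ?_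
  · ext ⟨x, y⟩
    simp only [Rneg, mem_iUnion, Finset.mem_Icc, mem_ofPred_eq, exists_prop, mem_prod, mem_Icc,
      Nat.add_sub_cancel]
    constructor
    · rintro ⟨i, ⟨h1, h2⟩, ⟨h3, h4⟩, h5, h6⟩
      obtain ⟨i, rfl⟩ := Nat.exists_eq_add_of_le' h1
      push_cast at h4 h6
      exact ⟨i, by omega, ⟨h3, h4⟩, h5, by push_cast; linarith⟩
    · rintro ⟨i, hi, ⟨h3, h4⟩, h5, h6⟩
      push_cast at h6
      exact ⟨i + 1, ⟨by omega, by omega⟩, ⟨h3, by push_cast; exact h4⟩, h5,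
        by push_cast; linarith⟩
  · simp
  · simp

lemma volume_SX {j : ℕ} (hj : 1 ≤ j) :
    volume (SX j) = ((22 * j ^ 2 + 14 * j + 2 : ℕ) : ℝ≥0∞) := by
  have hpos : (0 : ℝ) < stepB j j := by exact_mod_cast stepB_self_pos j
  rw [SX_eq_staircase hj, volume_staircase (stepA_cast_strictMono j)
    (stepB_cast_strictAnti j)
    (by rw [stepA_zero hj]; push_cast; linarith [j.cast_nonneg (α := ℝ)])
    (by linarith [j.cast_nonneg (α := ℝ)]), ← ENNReal.ofReal_natCast]
  congr 1
  have hsum := sum_range_stepA_stepB hj (4 * j + 1) j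
  rw [if_neg (by omega), stepA_self hj] at hsum
  have hsum' := congrArg (Int.cast : ℤ → ℝ) hsum
  push_cast at hsum'
  rw [hsum', stepA_zero hj, stepB_zero]
  push_cast
  ring

lemma ncard_isReflexCorner_SX {j : ℕ} (hj : 1 ≤ j) :
    Set.ncard {p : ℝ × ℝ | IsReflexCorner (SX j) p} = j := by
  have hpos : (0 : ℝ) < stepB j j := by exact_mod_cast stepB_self_pos j
  rw [SX_eq_staircase hj]
  exact ncard_isReflexCorner_staircase (stepA_cast_strictMono j)
    (stepB_cast_strictAnti j)
    (by rw [stepA_zero hj]; push_cast; linarith [j.cast_nonneg (α := ℝ)])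
    (by linarith [j.cast_nonneg (α := ℝ)])

lemma volume_SXneg {m : ℕ} (hm : 1 ≤ m) :
    volume (SXneg m) = ENNReal.ofReal (22 * m ^ 2 - 12 * m + 2) := by
  rw [SXneg_eq_staircase hm]
  obtain ⟨n, rfl⟩ := Nat.exists_eq_add_of_le' hm
  have hn : (0 : ℝ) ≤ n := n.cast_nonneg
  rw [Nat.add_sub_cancel, volume_staircase (fun i k hik ↦ by simpa using hik)
    (fun i k hik ↦ by simpa using hik) (by push_cast; linarith) (by push_cast; linarith)]
  congr 1
  have hsum : ∀ (c : ℝ) (k : ℕ), ∑ i ∈ Finset.range k,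
      (2 * (((i + 1 : ℕ) : ℝ) + 1) - 2 * ((i : ℝ) + 1)) * (c - 2 * ((i + 1 : ℕ) : ℝ)) =
        2 * k * (c - 1 - k) := by
    intro c k
    induction k with
    | zero => simp
    | succ k ih =>
      rw [Finset.sum_range_succ, ih]
      push_cast
      ring
  have hsum' := hsum (2 * ((n + 1 : ℕ) : ℝ) - 1 + (4 * ((n + 1 : ℕ) : ℝ) - 1)) n
  simp only [sub_add_eq_add_sub] at hsum' ⊢
  rw [hsum']
  push_cast
  ring

lemma ncard_isReflexCorner_SXneg {m : ℕ} (hm : 1 ≤ m) :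
    Set.ncard {p : ℝ × ℝ | IsReflexCorner (SXneg m) p} = m - 1 := by
  rw [SXneg_eq_staircase hm]
  obtain ⟨n, rfl⟩ := Nat.exists_eq_add_of_le' hm
  have hn : (0 : ℝ) ≤ n := n.cast_nonneg
  exact ncard_isReflexCorner_staircase (fun i k hik ↦ by simpa using hik)
    (fun i k hik ↦ by simpa using hik) (by push_cast; linarith)
    (by push_cast [Nat.add_sub_cancel]; linarith)

/-- Area minus number of reflex corners minus the lens space surgery coefficient
`22j² + 13j + 2` of `k_X(j)`: it is `0` for `j ≥ 1` (i.e. `Area = N + (22j²+13j+2)`)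
and `1` for `j = −m ≤ −2` (i.e. `Area = N + (22m²−13m+2) + 1`). -/
theorem stmt_4 :
    (∀ j : ℕ, 1 ≤ j →
      volume (SX j) =
        (((Set.ncard {p : ℝ × ℝ | IsReflexCorner (SX j) p}) +
          (22 * j ^ 2 + 13 * j + 2) : ℕ) : ℝ≥0∞)) ∧
    (∀ m : ℕ, 2 ≤ m →
      volume (SXneg m) =
        (((Set.ncard {p : ℝ × ℝ | IsReflexCorner (SXneg m) p}) +
          (22 * m ^ 2 - 13 * m + 2) + 1 : ℕ) : ℝ≥0∞)) := by
  refine ⟨fun j hj ↦ ?_, fun m hm ↦ ?_⟩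
  · rw [volume_SX hj, ncard_isReflexCorner_SX hj]
    congr 1
    ring
  · have hm1 : 1 ≤ m := by omega
    have hle : 13 * m ≤ 22 * m ^ 2 := by nlinarith
    rw [volume_SXneg hm1, ncard_isReflexCorner_SXneg hm1, ← ENNReal.ofReal_natCast]
    congr 1
    push_cast [Nat.cast_sub hle, Nat.cast_sub hm1]
    ring
end

section
/- For every integer j ≥ 1, the number of even lattice points lying in the topological interior of the region S_X(j) = R(j) ∪ ([−(2j+1),0] × [0,2j+1]) ∪ ([−(2j+1),2j] × [−(4j+1),0]) ⊆ ℝ² equals 11j² + 2j, which is the Seifert genus of the Berge sporadic knot k_X(j). -/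
open MeasureTheory Set ENNReal

/-- `p ∈ ℝ²` is an even lattice point: `p = (x,y)` with `x, y ∈ ℤ` and `x + y` even. -/
def IsEvenLatticePt (p : ℝ × ℝ) : Prop :=
  ∃ x y : ℤ, p.1 = (x : ℝ) ∧ p.2 = (y : ℝ) ∧ Even (x + y)

/-- Closed form of the corners `(a_i^{(j)}, b_i^{(j)})`. -/
theorem ab_eq (j i : ℕ) (hj : 1 ≤ j) (hi : 1 ≤ i) (hij : i ≤ j + 1) :
    ab j i = (if i ≤ (j + 1) / 2 then 2 * (i : ℤ) - 1 else 2 * i - 2,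
      if i ≤ (j + 1) / 2 + 1 then 2 * (j : ℤ) + 3 - 2 * i else 2 * j + 4 - 2 * i) := by
  induction j, hj using Nat.le_induction generalizing i with
  | base =>
    obtain rfl | rfl : i = 1 ∨ i = 2 := by omega
    · simp [ab]
    · simp [ab]
  | succ j hj ih =>
    obtain ⟨k, rfl⟩ := Nat.exists_eq_add_of_le' hj
    rw [ab]
    split_ifs with h1
    all_goals first
      | (rw [ih _ (by omega) (by omega)]
         ext <;> dsimp only <;> split_ifs <;>
           push_cast [Nat.cast_sub (show i ≤ k + 2 + 2 by omega)] <;> omega)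
      | (ext <;> dsimp only <;> push_cast <;> omega)

/-- The region `S_X(j)` is a union of rectangles sharing their lower left corner. -/
theorem SX_eq_iUnion (j : ℕ) (hj : 1 ≤ j) :
    SX j = ⋃ i ∈ Finset.Icc 1 (j + 1),
      Set.Icc (-(2 * (j : ℝ) + 1)) ((ab j i).1 : ℝ) ×ˢ
        Set.Icc (-(4 * (j : ℝ) + 1)) ((ab j i).2 : ℝ) := by
  have hj0 : (1 : ℝ) ≤ j := by exact_mod_cast hj
  have hfirst : ab j 1 = (1, 2 * (j : ℤ) + 1) := by
    rw [ab_eq j 1 hj le_rfl (by omega)]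
    ext <;> dsimp only <;> split_ifs <;> push_cast <;> omega
  have hlast1 : (ab j (j + 1)).1 = 2 * (j : ℤ) := by
    rw [ab_eq j (j + 1) hj (by omega) le_rfl]
    dsimp only
    split_ifs <;> push_cast <;> omega
  have hlast2 : 0 ≤ (ab j (j + 1)).2 := by
    rw [ab_eq j (j + 1) hj (by omega) le_rfl]
    dsimp only
    split_ifs <;> push_cast <;> omega
  ext ⟨x, y⟩
  simp only [SX, Rreg, mem_union, mem_iUnion, mem_prod, mem_Icc, Finset.mem_Icc, exists_prop]
  constructor
  · rintro ((⟨i, hi, ⟨h1, h2⟩, h3, h4⟩ | ⟨⟨h1, h2⟩, h3, h4⟩) | ⟨⟨h1, h2⟩, h3, h4⟩)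
    · exact ⟨i, hi, ⟨by linarith, h2⟩, by linarith, h4⟩
    · refine ⟨1, ⟨le_rfl, by omega⟩, ?_⟩
      rw [hfirst]
      push_cast
      exact ⟨⟨h1, by linarith⟩, by linarith, h4⟩
    · refine ⟨j + 1, ⟨by omega, le_rfl⟩, ?_⟩
      have h5 : (0 : ℝ) ≤ ((ab j (j + 1)).2 : ℝ) := by exact_mod_cast hlast2
      rw [hlast1]
      push_cast
      exact ⟨⟨h1, h2⟩, h3, by linarith⟩
  · rintro ⟨i, hi, ⟨h1, h2⟩, h3, h4⟩
    have ha : (ab j i).1 ≤ 2 * (j : ℤ) := by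
      rw [ab_eq j i hj hi.1 hi.2]
      dsimp only
      split_ifs <;> omega
    have hb : (ab j i).2 ≤ 2 * (j : ℤ) + 1 := by
      rw [ab_eq j i hj hi.1 hi.2]
      dsimp only
      split_ifs <;> omega
    have ha' : ((ab j i).1 : ℝ) ≤ 2 * (j : ℝ) := by exact_mod_cast ha
    have hb' : ((ab j i).2 : ℝ) ≤ 2 * (j : ℝ) + 1 := by exact_mod_cast hb
    rcases le_total y 0 with hy | hy
    · exact Or.inr ⟨⟨h1, by linarith⟩, h3, hy⟩
    · rcases le_total x 0 with hx | hx
      · exact Or.inl (Or.inr ⟨⟨h1, hx⟩, hy, by linarith⟩)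
      · exact Or.inl (Or.inl ⟨i, hi, ⟨hx, h2⟩, hy, h4⟩)

/-- The interior of a finite union of closed rectangles with a common lower left corner. -/
theorem mem_interior_iUnion_Icc_prod {ι : Type*} (s : Finset ι) (c d : ℝ) (a b : ι → ℝ)
    (p : ℝ × ℝ) :
    p ∈ interior (⋃ i ∈ s, Set.Icc c (a i) ×ˢ Set.Icc d (b i)) ↔
      ∃ i ∈ s, (c < p.1 ∧ p.1 < a i) ∧ d < p.2 ∧ p.2 < b i := by
  constructor
  · intro hp
    obtain ⟨ε, hε, hball⟩ := Metric.mem_nhds_iff.1 (mem_interior_iff_mem_nhds.1 hp)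
    have hmem : ∀ δ : ℝ, |δ| < ε → ∃ i ∈ s,
        (c ≤ p.1 + δ ∧ p.1 + δ ≤ a i) ∧ d ≤ p.2 + δ ∧ p.2 + δ ≤ b i := by
      intro δ hδ
      have : (p.1 + δ, p.2 + δ) ∈ Metric.ball p ε := by
        simpa [Metric.mem_ball, Prod.dist_eq, Real.dist_eq] using hδ
      simpa only [mem_iUnion, exists_prop, mem_prod, mem_Icc] using hball this
    obtain ⟨i, hi, ⟨-, h1⟩, -, h2⟩ := hmem (ε / 2) (by rw [abs_of_pos] <;> linarith)
    obtain ⟨-, -, ⟨h3, -⟩, h4, -⟩ := hmem (-(ε / 2)) (by rw [abs_neg, abs_of_pos] <;> linarith)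
    exact ⟨i, hi, ⟨by linarith, by linarith⟩, by linarith, by linarith⟩
  · rintro ⟨i, hi, h1, h2⟩
    refine mem_interior.2 ⟨Set.Ioo c (a i) ×ˢ Set.Ioo d (b i), ?_, isOpen_Ioo.prod isOpen_Ioo,
      h1, h2⟩
    exact (Set.prod_mono Ioo_subset_Icc_self Ioo_subset_Icc_self).trans
      (Set.subset_biUnion_of_mem (u := fun i => Set.Icc c (a i) ×ˢ Set.Icc d (b i)) hi)

/-- The number of even lattice points interior to `S_X(j)` in the column `x = n - 2j`. -/
def columnCount (j n : ℕ) : ℕ :=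
  if n < 2 * j then 3 * j + 1 - n % 2
  else if (n - 2 * j) / 2 < (j + 1) / 2 then 3 * j + 1 - (n - 2 * j) / 2 - 2 * (n % 2)
  else 3 * j - (n - 2 * j) / 2

/-- Sum of a function over the first `2 * N` naturals, two terms at a time. -/
theorem sum_range_two_mul {M : Type*} [AddCommMonoid M] (f : ℕ → M) (N : ℕ) :
    ∑ n ∈ Finset.range (2 * N), f n =
      ∑ m ∈ Finset.range N, (f (2 * m) + f (2 * m + 1)) := by
  induction N with
  | zero => simp
  | succ N ih =>
    rw [Nat.mul_succ, Finset.sum_range_succ, Finset.sum_range_succ, ih, Finset.sum_range_succ,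
      add_assoc]

theorem sum_columnCount (j : ℕ) :
    ∑ n ∈ Finset.range (4 * j), columnCount j n = 11 * j ^ 2 + 2 * j := by
  have hleft : ∀ m ∈ Finset.range j,
      columnCount j (2 * m) + columnCount j (2 * m + 1) = 6 * j + 1 := by
    intro m hm
    rw [Finset.mem_range] at hm
    unfold columnCount
    split_ifs <;> omega
  have hright : ∀ m ∈ Finset.range j,
      columnCount j (2 * (j + m)) + columnCount j (2 * (j + m) + 1) = 6 * j - 2 * m := by
    intro m hm
    rw [Finset.mem_range] at hm
    unfold columnCount
    split_ifs <;> omega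
  have hsum : ∀ N ≤ j, ∑ m ∈ Finset.range N, (6 * j - 2 * m) + N * N = 6 * j * N + N := by
    intro N hN
    induction N with
    | zero => simp
    | succ N ih =>
      have := ih (by omega)
      rw [Finset.sum_range_succ]
      zify [show 2 * N ≤ 6 * j by omega] at this ⊢
      linarith
  rw [show 4 * j = 2 * (j + j) by ring, sum_range_two_mul, Finset.sum_range_add,
    Finset.sum_congr rfl hleft, Finset.sum_congr rfl hright]
  have := hsum j le_rfl
  simp only [Finset.sum_const, Finset.card_range, smul_eq_mul]
  nlinarith

/-- A lattice point of the right parity lies under the staircase of corners exactly when its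
position in its column is less than `columnCount`. -/
theorem lt_columnCount_iff (j n k : ℕ) (hj : 1 ≤ j) :
    (n < 4 * j ∧ k < columnCount j n) ↔ ∃ i ∈ Finset.Icc 1 (j + 1),
      (n : ℤ) - 2 * j < (ab j i).1 ∧ -(4 * (j : ℤ)) + n % 2 + 2 * k < (ab j i).2 := by
  constructor
  · rintro ⟨hn, hk⟩
    unfold columnCount at hk
    have key : ∀ i, 1 ≤ i → i ≤ j + 1 →
        ((n : ℤ) - 2 * j < (if i ≤ (j + 1) / 2 then 2 * (i : ℤ) - 1 else 2 * i - 2) ∧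
          -(4 * (j : ℤ)) + n % 2 + 2 * k <
            if i ≤ (j + 1) / 2 + 1 then 2 * (j : ℤ) + 3 - 2 * i else 2 * j + 4 - 2 * i) →
        ∃ i ∈ Finset.Icc 1 (j + 1),
          (n : ℤ) - 2 * j < (ab j i).1 ∧ -(4 * (j : ℤ)) + n % 2 + 2 * k < (ab j i).2 := by
      intro i h1 h2 h
      exact ⟨i, Finset.mem_Icc.2 ⟨h1, h2⟩, by rw [ab_eq j i hj h1 h2]; exact h⟩
    by_cases h1 : n < 2 * j
    · rw [if_pos h1] at hk
      refine key 1 le_rfl (by omega) ⟨?_, ?_⟩ <;> split_ifs <;> omega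
    · rw [if_neg h1] at hk
      have hmod := Nat.mod_two_eq_zero_or_one n
      by_cases h2 : (n - 2 * j) / 2 < (j + 1) / 2
      · rw [if_pos h2] at hk
        refine key ((n - 2 * j + 1) / 2 + 1) (by omega) (by omega) ⟨?_, ?_⟩ <;>
          rcases hmod with hmod | hmod <;> rw [hmod] at hk <;> split_ifs <;> omega
      · rw [if_neg h2] at hk
        refine key ((n - 2 * j) / 2 + 2) (by omega) (by omega) ⟨?_, ?_⟩ <;>
          split_ifs <;> omega
  · rintro ⟨i, hi, h⟩
    rw [Finset.mem_Icc] at hi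
    rw [ab_eq j i hj hi.1 hi.2] at h
    dsimp only at h
    obtain ⟨h1, h2⟩ := h
    unfold columnCount
    constructor
    · split_ifs at h1 <;> omega
    · rcases Nat.mod_two_eq_zero_or_one n with hmod | hmod <;> rw [hmod] <;>
        split_ifs at h1 h2 ⊢ <;> omega

/-- For every integer `j ≥ 1`, the number of even lattice points in the interior of
`S_X(j)` equals `11j² + 2j`, the Seifert genus of the Berge sporadic knot `k_X(j)`. -/
theorem stmt_9 (j : ℕ) (hj : 1 ≤ j) :
    Set.ncard {p : ℝ × ℝ | IsEvenLatticePt p ∧ p ∈ interior (SX j)} =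
      11 * j ^ 2 + 2 * j := by
  set T : Finset (Σ _ : ℕ, ℕ) :=
    (Finset.range (4 * j)).sigma fun n => Finset.range (columnCount j n) with hT
  set f : (Σ _ : ℕ, ℕ) → ℝ × ℝ := fun q =>
    (((q.1 : ℤ) - 2 * j : ℤ), (-(4 * (j : ℤ)) + q.1 % 2 + 2 * q.2 : ℤ)) with hf
  have hinj : Set.InjOn f T := by
    rintro ⟨n, k⟩ - ⟨n', k'⟩ - h
    simp only [hf, Prod.mk.injEq, Int.cast_inj] at h
    obtain rfl : n = n' := by omega
    obtain rfl : k = k' := by omega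
    rfl
  have hset : {p : ℝ × ℝ | IsEvenLatticePt p ∧ p ∈ interior (SX j)} = f '' T := by
    ext ⟨u, v⟩
    rw [mem_ofPred_eq, SX_eq_iUnion j hj, mem_interior_iUnion_Icc_prod]
    constructor
    · rintro ⟨⟨x, y, hx, hy, hxy⟩, i, hi, ⟨h1, h2⟩, h3, h4⟩
      dsimp only at hx hy h1 h2 h3 h4
      subst hx hy
      have h1' : -(2 * (j : ℤ) + 1) < x := by exact_mod_cast h1
      have h2' : x < (ab j i).1 := by exact_mod_cast h2
      have h3' : -(4 * (j : ℤ) + 1) < y := by exact_mod_cast h3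
      have h4' : y < (ab j i).2 := by exact_mod_cast h4
      rw [Int.even_iff] at hxy
      have hn : ((x + 2 * j).toNat : ℤ) = x + 2 * j := Int.toNat_of_nonneg (by omega)
      have hk : (((y + 4 * j) / 2).toNat : ℤ) = (y + 4 * j) / 2 :=
        Int.toNat_of_nonneg (by omega)
      refine ⟨⟨(x + 2 * j).toNat, ((y + 4 * j) / 2).toNat⟩, ?_, ?_⟩
      · rw [hT, Finset.mem_coe, Finset.mem_sigma, Finset.mem_range, Finset.mem_range,
          lt_columnCount_iff j _ _ hj]
        refine ⟨i, hi, ?_, ?_⟩ <;> dsimp only <;> omega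
      · simp only [hf, Prod.mk.injEq, Int.cast_inj]
        constructor <;> omega
    · rintro ⟨⟨n, k⟩, hq, h⟩
      rw [hT, Finset.mem_coe, Finset.mem_sigma, Finset.mem_range, Finset.mem_range,
        lt_columnCount_iff j _ _ hj] at hq
      obtain ⟨i, hi, h1, h2⟩ := hq
      simp only [hf, Prod.mk.injEq] at h
      obtain ⟨rfl, rfl⟩ := h
      refine ⟨⟨_, _, rfl, rfl, ?_⟩, i, hi, ⟨?_, ?_⟩, ?_, ?_⟩
      · rw [Int.even_iff]
        omega
      · have : -(2 * (j : ℤ) + 1) < (n : ℤ) - 2 * j := by omega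
        dsimp only
        exact_mod_cast this
      · exact Int.cast_lt.2 h1
      · have : -(4 * (j : ℤ) + 1) < -(4 * (j : ℤ)) + n % 2 + 2 * k := by omega
        dsimp only
        exact_mod_cast this
      · exact Int.cast_lt.2 h2
  rw [hset, hinj.ncard_image, Set.ncard_coe_finset, hT, Finset.card_sigma]
  simp only [Finset.card_range]
  exact sum_columnCount j
end

section
/- For every integer m ≥ 2, the number of even lattice points lying in the topological interior of the region S_X(−m) = R₋(m) ∪ ([−(2m−1),0] × [0,2m−1]) ∪ ([−(2m−1),2m] × [−(4m−1),0]) ⊆ ℝ² equals 11m² − 11m + 3, which is the Seifert genus of the Berge sporadic knot k_X(−m). -/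
open MeasureTheory Set ENNReal

lemma mem_SXneg {m : ℕ} {u v : ℝ} : (u, v) ∈ SXneg m ↔
    ((∃ i : ℕ, (1 ≤ i ∧ i ≤ m) ∧ (0 ≤ u ∧ u ≤ 2 * i) ∧ 0 ≤ v ∧ v ≤ 2 * m + 1 - 2 * i) ∨
      (-(2 * m - 1) ≤ u ∧ u ≤ 0) ∧ 0 ≤ v ∧ v ≤ 2 * m - 1) ∨
      (-(2 * m - 1) ≤ u ∧ u ≤ 2 * m) ∧ -(4 * m - 1) ≤ v ∧ v ≤ 0 := by
  simp only [SXneg, Rneg, mem_union, mem_iUnion, mem_prod, mem_Icc, Finset.mem_Icc, exists_prop]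

/-- An interior point of a planar set can be moved a little along the diagonal, both ways. -/
lemma exists_diagonal_of_mem_interior {S : Set (ℝ × ℝ)} {u v : ℝ} (h : (u, v) ∈ interior S) :
    ∃ δ > 0, (u + δ, v + δ) ∈ S ∧ (u - δ, v - δ) ∈ S := by
  obtain ⟨ε, hε, hS⟩ := Metric.mem_nhds_iff.1 (mem_interior_iff_mem_nhds.1 h)
  refine ⟨ε / 2, by positivity, hS ?_, hS ?_⟩ <;>
    simp [Prod.dist_eq, abs_of_pos hε, hε]

/-- The staircase is, as far as even lattice points are concerned, cut off by an antidiagonal. -/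
lemma intCast_mem_interior_SXneg {m : ℕ} (hm : 1 ≤ m) {x y : ℤ} (hxy : Even (x + y)) :
    ((x : ℝ), (y : ℝ)) ∈ interior (SXneg m) ↔
      (-(2 * m - 1) < x ∧ x < 2 * m) ∧ (-(4 * m - 1) < y ∧ y < 2 * m - 1) ∧ x + y < 2 * m := by
  obtain ⟨k, hk⟩ := hxy
  constructor
  · intro h
    obtain ⟨δ, hδ, h₁, h₂⟩ := exists_diagonal_of_mem_interior h
    rw [mem_SXneg] at h₁ h₂
    have hm' : (1 : ℝ) ≤ m := by exact_mod_cast hm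
    have lower : -(2 * m - 1) < x ∧ -(4 * m - 1) < y := by
      rify
      rcases h₂ with (⟨i, _, _, _⟩ | _) | _ <;> constructor <;> linarith
    have upper : (∃ i : ℕ, (1 ≤ i ∧ i ≤ m) ∧ x < 2 * i ∧ y < 2 * m + 1 - 2 * i) ∨
        (x < 0 ∧ y < 2 * m - 1) ∨ (x < 2 * m ∧ y < 0) := by
      rify
      rcases h₁ with (⟨i, hi, _, _⟩ | _) | _
      · exact .inl ⟨i, by exact_mod_cast hi, by linarith, by linarith⟩
      · exact .inr (.inl ⟨by linarith, by linarith⟩)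
      · exact .inr (.inr ⟨by linarith, by linarith⟩)
    rcases upper with ⟨i, _⟩ | _ | _ <;> omega
  · rintro ⟨⟨hx₁, hx₂⟩, ⟨hy₁, hy₂⟩, hs⟩
    rw [mem_interior]
    refine ⟨Ioo (x - 1 : ℝ) (x + 1) ×ˢ Ioo (y - 1 : ℝ) (y + 1), ?_,
      isOpen_Ioo.prod isOpen_Ioo, by simp⟩
    rintro ⟨u, v⟩ ⟨⟨hu₁, hu₂⟩, hv₁, hv₂⟩
    dsimp only at hu₁ hu₂ hv₁ hv₂
    rw [mem_SXneg]
    have hx₁' : -(2 * m - 1) ≤ (x : ℝ) - 1 := by exact_mod_cast (by omega : -(2 * m - 1) ≤ x - 1)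
    have hx₂' : (x : ℝ) + 1 ≤ 2 * m := by exact_mod_cast hx₂
    have hy₁' : -(4 * m - 1) ≤ (y : ℝ) - 1 := by exact_mod_cast (by omega : -(4 * m - 1) ≤ y - 1)
    have hy₂' : (y : ℝ) + 1 ≤ 2 * m - 1 := by exact_mod_cast (by omega : y + 1 ≤ 2 * (m : ℤ) - 1)
    rcases le_or_gt v 0 with hv | hv
    · exact .inr ⟨⟨by linarith, by linarith⟩, by linarith, hv⟩
    rcases le_or_gt u 0 with hu | hu
    · exact .inl (.inr ⟨⟨by linarith, hu⟩, hv.le, by linarith⟩)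
    have hx₀ : 0 < x + 1 := by exact_mod_cast hu.trans hu₂
    have hy₀ : 0 < y + 1 := by exact_mod_cast hv.trans hv₂
    obtain ⟨i, hi⟩ := Int.eq_ofNat_of_zero_le (show 0 ≤ (x + 2) / 2 by omega)
    have hxi : (x : ℝ) + 1 ≤ 2 * i := by exact_mod_cast (by omega : x + 1 ≤ 2 * (i : ℤ))
    have hyi : (y : ℝ) + 1 ≤ 2 * m + 1 - 2 * i := by
      exact_mod_cast (by omega : y + 1 ≤ 2 * (m : ℤ) + 1 - 2 * i)
    exact .inl (.inl ⟨i, by omega, ⟨hu.le, by linarith⟩, hv.le, by linarith⟩)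

/-- Index set for the even lattice points in the interior of `SXneg (n + 1)`: the pair `(a, b)`
stands for the point of height `b - (4 * n + 2)` in the `a`-th pair of adjacent columns. -/
def evenPointIndex (n : ℕ) : Finset (Σ _ : ℕ, ℕ) :=
  (Finset.range (n + (n + 1))).sigma fun a => Finset.range (6 * n + 3 - 2 * (a - n))

/-- The even lattice point with a given index. -/
def evenPoint (n : ℕ) (q : Σ _ : ℕ, ℕ) : ℝ × ℝ :=
  (((2 * (q.1 - n) + (q.2 : ℤ) % 2 : ℤ) : ℝ), ((q.2 - (4 * n + 2) : ℤ) : ℝ))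

lemma evenPoint_injective (n : ℕ) : Function.Injective (evenPoint n) := by
  rintro ⟨a, b⟩ ⟨c, d⟩ h
  simp only [evenPoint, Prod.mk.injEq, Int.cast_inj] at h
  obtain rfl : a = c := by omega
  obtain rfl : b = d := by omega
  rfl

lemma card_evenPointIndex (n : ℕ) : (evenPointIndex n).card = 11 * n ^ 2 + 11 * n + 3 := by
  have right (k : ℕ) (hk : k ≤ 3 * n + 2) :
      ∑ i ∈ Finset.range k, (6 * n + 3 - 2 * i) + k * k = k * (6 * n + 4) := by
    induction k with
    | zero => simp
    | succ k ih =>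
      have := ih (by omega)
      rw [Finset.sum_range_succ]
      have : 6 * n + 3 - 2 * k + 2 * k = 6 * n + 3 := by omega
      linarith
  have left : ∑ a ∈ Finset.range n, (6 * n + 3 - 2 * (a - n)) = n * (6 * n + 3) := by
    rw [Finset.sum_congr rfl (g := fun _ => 6 * n + 3)]
    · simp
    · intro a ha
      have := Finset.mem_range.1 ha
      omega
  have := right (n + 1) (by omega)
  simp only [evenPointIndex, Finset.card_sigma, Finset.card_range]
  rw [Finset.sum_range_add, left]
  simp only [Nat.add_sub_cancel_left]
  linarith

lemma setOf_isEvenLatticePt_interior_SXneg (n : ℕ) :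
    {p : ℝ × ℝ | IsEvenLatticePt p ∧ p ∈ interior (SXneg (n + 1))} =
      evenPoint n '' evenPointIndex n := by
  ext ⟨u, v⟩
  simp only [mem_ofPred_eq, mem_image, Finset.mem_coe, evenPointIndex, Finset.mem_sigma,
    Finset.mem_range]
  constructor
  · rintro ⟨⟨x, y, rfl, rfl, hxy⟩, h⟩
    rw [intCast_mem_interior_SXneg (by omega) hxy] at h
    obtain ⟨k, hk⟩ := hxy
    push_cast at h
    refine ⟨⟨(x / 2 + n).toNat, (y + (4 * n + 2)).toNat⟩, ⟨by dsimp only; omega, by dsimp only; omega⟩, ?_⟩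
    simp only [evenPoint, Prod.mk.injEq, Int.cast_inj]
    omega
  · rintro ⟨⟨a, b⟩, ⟨ha, hb⟩, h⟩
    simp only at ha hb
    simp only [evenPoint, Prod.mk.injEq] at h
    obtain ⟨rfl, rfl⟩ := h
    have hxy : Even ((2 * (a - n) + (b : ℤ) % 2) + (b - (4 * n + 2) : ℤ)) := by
      rw [Int.even_iff]
      omega
    refine ⟨⟨_, _, rfl, rfl, hxy⟩, (intCast_mem_interior_SXneg (by omega) hxy).2 ?_⟩
    push_cast
    omega

/-- For every integer `m ≥ 2`, the number of even lattice points in the interior of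
`S_X(−m)` equals `11m² − 11m + 3`, the Seifert genus of the Berge sporadic knot `k_X(−m)`. -/
theorem stmt_10 (m : ℕ) (hm : 2 ≤ m) :
    Set.ncard {p : ℝ × ℝ | IsEvenLatticePt p ∧ p ∈ interior (SXneg m)} =
      11 * m ^ 2 - 11 * m + 3 := by
  obtain ⟨n, rfl⟩ := Nat.exists_eq_add_of_le' (show 1 ≤ m by omega)
  rw [setOf_isEvenLatticePt_interior_SXneg, ncard_image_of_injective _ (evenPoint_injective n),
    ncard_coe_finset, card_evenPointIndex]
  have : 11 * (n + 1) ^ 2 = 11 * n ^ 2 + 11 * n + 11 * (n + 1) := by ring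
  omega
end

section
/- For every integer j ≥ 1, the 2-dimensional Lebesgue measure of the region S_IX(j) = R(j) ∪ ([0,2j] × [−2j,0]) ∪ ([−(4j+1),0] × [−2j, 2j+1]) ⊆ ℝ² equals 22j² + 10j + 1. -/
open MeasureTheory Set ENNReal

/-- The region of `P_IX(j)` for `j ≥ 1`:
`S_IX(j) = R(j) ∪ ([0,2j] × [−2j,0]) ∪ ([−(4j+1),0] × [−2j, 2j+1])`. -/
def SIX (j : ℕ) : Set (ℝ × ℝ) :=
  Rreg j ∪
    Set.Icc (0 : ℝ) (2 * (j : ℝ)) ×ˢ Set.Icc (-(2 * (j : ℝ))) (0 : ℝ) ∪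
    Set.Icc (-(4 * (j : ℝ) + 1)) (0 : ℝ) ×ˢ Set.Icc (-(2 * (j : ℝ))) (2 * (j : ℝ) + 1)

lemma ab_one_left (j : ℕ) : ab (j + 1) 1 = (1, 2 * (j : ℤ) + 3) := by
  cases j with
  | zero => simp [ab]
  | succ j =>
    simp only [ab, if_true, Prod.mk.injEq, true_and]
    push_cast
    ring

lemma ab_succ {j i : ℕ} (hi : i ≠ 1) :
    ab (j + 2) i = ((ab (j + 1) (j + 4 - i)).2 + 1, (ab (j + 1) (j + 4 - i)).1 + 1) := by
  simp [ab, hi]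

lemma ab_bounds (j : ℕ) : ∀ i ∈ Finset.Icc 1 (j + 2),
    0 ≤ (ab (j + 1) i).1 ∧ (ab (j + 1) i).1 ≤ 2 * j + 2 ∧
      0 ≤ (ab (j + 1) i).2 ∧ (ab (j + 1) i).2 ≤ 2 * j + 3 := by
  induction j with
  | zero =>
    intro i hi
    rw [Finset.mem_Icc] at hi
    obtain ⟨h1, h2⟩ := hi
    interval_cases i <;> simp [ab]
  | succ j ih =>
    intro i hi
    rw [Finset.mem_Icc] at hi
    by_cases h : i = 1
    · subst h
      rw [ab_one_left]
      dsimp only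
      omega
    · have := ih (j + 4 - i) (by rw [Finset.mem_Icc]; omega)
      rw [ab_succ h]
      dsimp only
      push_cast
      omega

lemma mem_Rreg {j : ℕ} {p : ℝ × ℝ} :
    p ∈ Rreg j ↔ ∃ i ∈ Finset.Icc 1 (j + 1),
      (0 ≤ p.1 ∧ p.1 ≤ (ab j i).1) ∧ (0 ≤ p.2 ∧ p.2 ≤ (ab j i).2) := by
  simp only [Rreg, mem_iUnion, mem_prod, mem_Icc, exists_prop]

lemma nonneg_of_mem_Rreg {j : ℕ} {p : ℝ × ℝ} (hp : p ∈ Rreg j) : 0 ≤ p.1 ∧ 0 ≤ p.2 := by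
  obtain ⟨i, -, h1, h2⟩ := mem_Rreg.1 hp
  exact ⟨h1.1, h2.1⟩

lemma measurableSet_Rreg (j : ℕ) : MeasurableSet (Rreg j) :=
  Finset.measurableSet_biUnion _ fun _ _ => measurableSet_Icc.prod measurableSet_Icc

/-- Reflect in the diagonal after translating by `(-1, -1)`. -/
def swapShift (p : ℝ × ℝ) : ℝ × ℝ := (p.2 - 1, p.1 - 1)

lemma measurePreserving_swapShift : MeasurePreserving swapShift volume volume :=
  (Measure.measurePreserving_swap (μ := (volume : Measure ℝ)) (ν := (volume : Measure ℝ))).comp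
    (measurePreserving_sub_right (volume : Measure (ℝ × ℝ)) (1, 1))

lemma Rreg_one : Rreg 1 = Icc (0 : ℝ) 1 ×ˢ Icc (0 : ℝ) 3 ∪ Icc (1 : ℝ) 2 ×ˢ Icc (0 : ℝ) 1 := by
  ext ⟨x, y⟩
  simp only [mem_Rreg, mem_union, mem_prod, mem_Icc]
  constructor
  · rintro ⟨i, hi, h⟩
    rw [Finset.mem_Icc] at hi
    obtain ⟨h1, h2⟩ := hi
    interval_cases i
    · simp [ab] at h
      grind
    · simp [ab] at h
      grind
  · rintro (h | h)
    · exact ⟨1, by simp, by simpa [ab] using h⟩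
    · refine ⟨2, by simp, ?_⟩
      simp [ab]
      grind

lemma Rreg_succ (j : ℕ) : Rreg (j + 2) =
    Icc (0 : ℝ) 1 ×ˢ Icc (0 : ℝ) (2 * j + 5) ∪ Icc (1 : ℝ) (2 * j + 4) ×ˢ Icc (0 : ℝ) 1 ∪
      swapShift ⁻¹' Rreg (j + 1) := by
  ext ⟨x, y⟩
  simp only [mem_union, mem_prod, mem_Icc, mem_preimage, mem_Rreg, swapShift]
  constructor
  · rintro ⟨i, hi, ⟨hx0, hx⟩, hy0, hy⟩
    rw [Finset.mem_Icc] at hi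
    by_cases h : i = 1
    · subst h
      rw [ab_one_left] at hx hy
      push_cast at hx hy
      left; left
      exact ⟨⟨hx0, hx⟩, hy0, by linarith⟩
    · have hmem : j + 4 - i ∈ Finset.Icc 1 (j + 2) := by rw [Finset.mem_Icc]; omega
      obtain ⟨-, ha, -, hb⟩ := ab_bounds j _ hmem
      rw [ab_succ h] at hx hy
      push_cast at hx hy
      have ha' : ((ab (j + 1) (j + 4 - i)).1 : ℝ) ≤ 2 * j + 2 := by exact_mod_cast ha
      have hb' : ((ab (j + 1) (j + 4 - i)).2 : ℝ) ≤ 2 * j + 3 := by exact_mod_cast hb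
      rcases le_total x 1 with hx1 | hx1
      · exact Or.inl (Or.inl ⟨⟨hx0, hx1⟩, hy0, by linarith⟩)
      rcases le_total y 1 with hy1 | hy1
      · exact Or.inl (Or.inr ⟨⟨hx1, by linarith⟩, hy0, hy1⟩)
      · exact Or.inr ⟨_, hmem, ⟨by linarith, by linarith⟩, by linarith, by linarith⟩
  · rintro ((⟨⟨hx0, hx⟩, hy0, hy⟩ | ⟨⟨hx0, hx⟩, hy0, hy⟩) | ⟨i, hi, ⟨hy0, hy⟩, hx0, hx⟩)
    · refine ⟨1, by simp, ?_⟩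
      rw [ab_one_left]
      push_cast
      exact ⟨⟨hx0, hx⟩, hy0, by linarith⟩
    · refine ⟨j + 3, by simp, ?_⟩
      rw [ab_succ (by omega), show j + 4 - (j + 3) = 1 by omega, ab_one_left]
      push_cast
      exact ⟨⟨by linarith, by linarith⟩, hy0, by linarith⟩
    · rw [Finset.mem_Icc] at hi
      refine ⟨j + 4 - i, by rw [Finset.mem_Icc]; omega, ?_⟩
      rw [ab_succ (by omega), show j + 4 - (j + 4 - i) = i by omega]
      push_cast
      exact ⟨⟨by linarith, by linarith⟩, by linarith, by linarith⟩

lemma aedisjoint_of_inter_subset_vertical {s t : Set (ℝ × ℝ)} (c : ℝ)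
    (h : ∀ p ∈ s, p ∈ t → p.1 = c) : AEDisjoint volume s t := by
  refine measure_mono_null (t := ({c} : Set ℝ) ×ˢ (univ : Set ℝ))
    (fun p hp => ⟨h p hp.1 hp.2, mem_univ _⟩) ?_
  rw [Measure.volume_eq_prod, Measure.prod_prod, Real.volume_singleton, zero_mul]

lemma aedisjoint_of_inter_subset_horizontal {s t : Set (ℝ × ℝ)} (c : ℝ)
    (h : ∀ p ∈ s, p ∈ t → p.2 = c) : AEDisjoint volume s t := by
  refine measure_mono_null (t := (univ : Set ℝ) ×ˢ ({c} : Set ℝ))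
    (fun p hp => ⟨mem_univ _, h p hp.1 hp.2⟩) ?_
  rw [Measure.volume_eq_prod, Measure.prod_prod, Real.volume_singleton, mul_zero]

lemma volume_Icc_prod_Icc_of_natCast {a b c d : ℝ} (m n : ℕ) (hm : b - a = m) (hn : d - c = n) :
    volume (Icc a b ×ˢ Icc c d) = ((m * n : ℕ) : ℝ≥0∞) := by
  rw [Measure.volume_eq_prod, Measure.prod_prod, Real.volume_Icc, Real.volume_Icc, hm, hn,
    ENNReal.ofReal_natCast, ENNReal.ofReal_natCast, Nat.cast_mul]

lemma measurableSet_Icc_prod_Icc (a b c d : ℝ) : MeasurableSet (Icc a b ×ˢ Icc c d) :=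
  measurableSet_Icc.prod measurableSet_Icc

lemma volume_Rreg (j : ℕ) :
    volume (Rreg (j + 1)) = ((2 * (j + 1) ^ 2 + 2 * (j + 1) : ℕ) : ℝ≥0∞) := by
  induction j with
  | zero =>
    rw [Rreg_one, measure_union₀ (measurableSet_Icc_prod_Icc _ _ _ _).nullMeasurableSet
        (aedisjoint_of_inter_subset_vertical 1 fun p hs ht => le_antisymm hs.1.2 ht.1.1),
      volume_Icc_prod_Icc_of_natCast 1 3 (by norm_num) (by norm_num),
      volume_Icc_prod_Icc_of_natCast 1 1 (by norm_num) (by norm_num), ← Nat.cast_add]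
    norm_num
  | succ j ih =>
    rw [Rreg_succ, measure_union₀, measure_union₀,
      measurePreserving_swapShift.measure_preimage (measurableSet_Rreg _).nullMeasurableSet, ih,
      volume_Icc_prod_Icc_of_natCast 1 (2 * j + 5) (by norm_num) (by push_cast; ring),
      volume_Icc_prod_Icc_of_natCast (2 * j + 3) 1 (by push_cast; ring) (by norm_num),
      ← Nat.cast_add, ← Nat.cast_add]
    · congr 1
      ring
    · exact (measurableSet_Icc_prod_Icc _ _ _ _).nullMeasurableSet
    · exact aedisjoint_of_inter_subset_vertical 1 fun p hs ht => le_antisymm hs.1.2 ht.1.1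
    · exact (measurePreserving_swapShift.measurable (measurableSet_Rreg _)).nullMeasurableSet
    · refine AEDisjoint.union_left ?_ ?_
      · refine aedisjoint_of_inter_subset_vertical 1 fun p hs ht => le_antisymm hs.1.2 ?_
        exact sub_nonneg.1 (nonneg_of_mem_Rreg ht).2
      · refine aedisjoint_of_inter_subset_horizontal 1 fun p hs ht => le_antisymm hs.2.2 ?_
        exact sub_nonneg.1 (nonneg_of_mem_Rreg ht).1

/-- For every integer `j ≥ 1`, the area of `S_IX(j)` equals `22j² + 10j + 1`. -/
theorem stmt_11 (j : ℕ) (hj : 1 ≤ j) :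
    volume (SIX j) = ((22 * j ^ 2 + 10 * j + 1 : ℕ) : ℝ≥0∞) := by
  have hR : volume (Rreg j) = ((2 * j ^ 2 + 2 * j : ℕ) : ℝ≥0∞) := by
    obtain ⟨k, rfl⟩ := Nat.exists_eq_add_of_le' hj
    exact volume_Rreg k
  rw [SIX, measure_union₀, measure_union₀, hR,
    volume_Icc_prod_Icc_of_natCast (2 * j) (2 * j) (by push_cast; ring) (by push_cast; ring),
    volume_Icc_prod_Icc_of_natCast (4 * j + 1) (4 * j + 1) (by push_cast; ring)
      (by push_cast; ring), ← Nat.cast_add, ← Nat.cast_add]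
  · congr 1
    ring
  · exact (measurableSet_Icc_prod_Icc _ _ _ _).nullMeasurableSet
  · exact aedisjoint_of_inter_subset_horizontal 0 fun p hs ht =>
      le_antisymm ht.2.2 (nonneg_of_mem_Rreg hs).2
  · exact (measurableSet_Icc_prod_Icc _ _ _ _).nullMeasurableSet
  · refine aedisjoint_of_inter_subset_vertical 0 fun p hs ht => le_antisymm ht.1.2 ?_
    exact hs.elim (fun h => (nonneg_of_mem_Rreg h).1) fun h => h.1.1
end

section
/- For every integer m ≥ 2, the 2-dimensional Lebesgue measure of the region S_X(−m) = R₋(m) ∪ ([−(2m−1),0] × [0,2m−1]) ∪ ([−(2m−1),2m] × [−(4m−1),0]) ⊆ ℝ² equals 22m² − 12m + 2. -/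
open MeasureTheory Set ENNReal

theorem volume_Icc_prod_Icc (a b c d : ℝ) (hab : a ≤ b) :
    volume (Icc a b ×ˢ Icc c d) = ENNReal.ofReal ((b - a) * (d - c)) := by
  rw [Measure.volume_eq_prod, Measure.prod_prod, Real.volume_Icc, Real.volume_Icc,
    ENNReal.ofReal_mul (sub_nonneg.2 hab)]

/-- The area of a staircase made of nested-corner rectangles `[0, 2i] × [0, c − 2i]`. -/
theorem volume_staircase_s14 (c : ℝ) (n : ℕ) (hn : 1 ≤ n) (hc : 2 * (n : ℝ) ≤ c) :
    volume (⋃ i ∈ Finset.Icc 1 n, Icc (0 : ℝ) (2 * (i : ℝ)) ×ˢ Icc (0 : ℝ) (c - 2 * (i : ℝ))) =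
      ENNReal.ofReal (2 * n * c - 2 * n * (n + 1)) := by
  induction n, hn using Nat.le_induction with
  | base =>
    simp only [Finset.Icc_self, Finset.mem_singleton, iUnion_iUnion_eq_left]
    rw [volume_Icc_prod_Icc _ _ _ _ (by norm_num)]
    congr 1
    push_cast
    ring
  | succ n hn ih =>
    push_cast at hc
    have hstep : (⋃ i ∈ Finset.Icc 1 (n + 1),
          Icc (0 : ℝ) (2 * (i : ℝ)) ×ˢ Icc (0 : ℝ) (c - 2 * (i : ℝ))) =
        (⋃ i ∈ Finset.Icc 1 n, Icc (0 : ℝ) (2 * (i : ℝ)) ×ˢ Icc (0 : ℝ) (c - 2 * (i : ℝ))) ∪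
          Ioc (2 * (n : ℝ)) (2 * (n + 1)) ×ˢ Icc (0 : ℝ) (c - 2 * (n + 1)) := by
      ext ⟨x, y⟩
      simp only [mem_iUnion, mem_union, mem_prod, mem_Icc, mem_Ioc, Finset.mem_Icc, exists_prop]
      constructor
      · rintro ⟨i, ⟨h1, h2⟩, ⟨hx0, hx⟩, hy0, hy⟩
        rcases Nat.lt_or_eq_of_le h2 with h | rfl
        · exact Or.inl ⟨i, ⟨h1, by omega⟩, ⟨hx0, hx⟩, hy0, hy⟩
        · push_cast at hx hy
          rcases le_or_gt x (2 * n) with h | h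
          · exact Or.inl ⟨n, ⟨hn, le_rfl⟩, ⟨hx0, h⟩, hy0, by linarith⟩
          · exact Or.inr ⟨⟨h, hx⟩, hy0, hy⟩
      · rintro (⟨i, ⟨h1, h2⟩, h⟩ | ⟨⟨hx0, hx⟩, hy0, hy⟩)
        · exact ⟨i, ⟨h1, by omega⟩, h⟩
        · have : (0 : ℝ) ≤ n := n.cast_nonneg
          exact ⟨n + 1, ⟨by omega, le_rfl⟩, ⟨by linarith, by push_cast; linarith⟩, hy0,
            by push_cast; linarith⟩
    have hdisj : Disjoint
        (⋃ i ∈ Finset.Icc 1 n, Icc (0 : ℝ) (2 * (i : ℝ)) ×ˢ Icc (0 : ℝ) (c - 2 * (i : ℝ)))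
        (Ioc (2 * (n : ℝ)) (2 * (n + 1)) ×ˢ Icc (0 : ℝ) (c - 2 * (n + 1))) := by
      rw [Set.disjoint_left]
      rintro ⟨x, y⟩ h ⟨⟨hx, -⟩, -⟩
      simp only [mem_iUnion, mem_prod, mem_Icc, Finset.mem_Icc, exists_prop] at h
      obtain ⟨i, ⟨-, h2⟩, ⟨-, hxi⟩, -⟩ := h
      have : (i : ℝ) ≤ n := by exact_mod_cast h2
      simp only at hx
      linarith
    have hn1 : (1 : ℝ) ≤ n := by exact_mod_cast hn
    rw [hstep, measure_union hdisj (measurableSet_Ioc.prod measurableSet_Icc), ih (by linarith),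
      Measure.volume_eq_prod, Measure.prod_prod, Real.volume_Ioc, Real.volume_Icc,
      ← ENNReal.ofReal_mul (by linarith), ← ENNReal.ofReal_add (by nlinarith) (by nlinarith)]
    congr 1
    push_cast
    ring

theorem aedisjoint_of_fst_separated {s t : Set (ℝ × ℝ)} (a : ℝ)
    (hs : ∀ p ∈ s, a ≤ p.1) (ht : ∀ p ∈ t, p.1 ≤ a) : AEDisjoint volume s t := by
  refine measure_mono_null (t := {a} ×ˢ univ)
    (fun p hp => ⟨le_antisymm (ht p hp.2) (hs p hp.1), mem_univ _⟩) ?_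
  rw [Measure.volume_eq_prod, Measure.prod_prod, Real.volume_singleton, zero_mul]

theorem aedisjoint_of_snd_separated {s t : Set (ℝ × ℝ)} (a : ℝ)
    (hs : ∀ p ∈ s, a ≤ p.2) (ht : ∀ p ∈ t, p.2 ≤ a) : AEDisjoint volume s t := by
  refine measure_mono_null (t := univ ×ˢ {a})
    (fun p hp => ⟨mem_univ _, le_antisymm (ht p hp.2) (hs p hp.1)⟩) ?_
  rw [Measure.volume_eq_prod, Measure.prod_prod, Real.volume_singleton, mul_zero]

theorem Rneg_nonneg {m : ℕ} {p : ℝ × ℝ} (hp : p ∈ Rneg m) : 0 ≤ p.1 ∧ 0 ≤ p.2 := by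
  simp only [Rneg, mem_iUnion] at hp
  obtain ⟨i, -, h⟩ := hp
  exact ⟨h.1.1, h.2.1⟩

theorem volume_Rneg (m : ℕ) (hm : 1 ≤ m) :
    volume (Rneg m) = ENNReal.ofReal (2 * (m : ℝ) ^ 2) := by
  rw [Rneg, volume_staircase_s14 _ m hm (by linarith)]
  congr 1
  ring

/-- For every integer `m ≥ 2`, the area of `S_X(−m)` equals `22m² − 12m + 2`. -/
theorem stmt_14 (m : ℕ) (hm : 2 ≤ m) :
    volume (SXneg m) = ((22 * m ^ 2 - 12 * m + 2 : ℕ) : ℝ≥0∞) := by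
  have hm' : (2 : ℝ) ≤ m := by exact_mod_cast hm
  have hsub : 12 * m ≤ 22 * m ^ 2 := by nlinarith
  rw [SXneg, measure_union₀ (measurableSet_Icc.prod measurableSet_Icc).nullMeasurableSet,
    measure_union₀ (measurableSet_Icc.prod measurableSet_Icc).nullMeasurableSet,
    volume_Rneg m (by omega), volume_Icc_prod_Icc _ _ _ _ (by linarith),
    volume_Icc_prod_Icc _ _ _ _ (by linarith), ← ENNReal.ofReal_add (by nlinarith) (by nlinarith),
    ← ENNReal.ofReal_add (by nlinarith) (by nlinarith), ← ENNReal.ofReal_natCast]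
  · congr 1
    push_cast [Nat.cast_sub hsub]
    ring
  · exact aedisjoint_of_fst_separated 0 (fun p hp => (Rneg_nonneg hp).1) fun p hp => hp.1.2
  · refine aedisjoint_of_snd_separated 0 ?_ fun p hp => hp.2.2
    rintro p (hp | hp)
    · exact (Rneg_nonneg hp).2
    · exact hp.2.1
end
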